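/- (Theorem 3.) Let π_n, η_n, π*_n be policies, β ∈ (0,1], ξ ≥ 0, and let π* be a policy minimizing J over all policies. Assume: (i) ρ₀(s) > 0 for all s ∈ S and d_{π_n}(s) > 0 for all s; (ii) realizability: E_{s∼d_{π_n}}[E_{a∼π*_n(·|s)}[A^{η_n}(s,a)]] = E_{s∼d_{π_n}}[min_{a∈A} A^{η_n}(s,a)]; (iii) for the statewise mixture π'_{n+1} = (1−β)π_n + βπ*_n, E_{s∼d_{π_n}}[E_{a∼π'_{n+1}(·|s)}[A^{η_n}(s,a)]] ≥ −ξ; and (iv) 0 ≤ Δ := J(π_n) − J(η_n) ≤ ξ. Then J(η_n) − J(π*) ≤ ( max_{s∈S} d_{π*}(s)/ρ₀(s) ) · ( ξ/(β(1−γ)²) + ξ/(β(1−γ)) ). -/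

import Mathlib

open scoped BigOperators

noncomputable section

/-- `p` is a probability distribution on a finite type. -/
def IsDist {X : Type*} [Fintype X] (p : X → ℝ) : Prop :=
  (∀ x, 0 ≤ p x) ∧ ∑ x, p x = 1

/-- `P` is a transition dynamics: `P s a` is a distribution over next states. -/
def IsDynamics {S A : Type*} [Fintype S] (P : S → A → S → ℝ) : Prop :=
  ∀ s a, IsDist (P s a)

/-- `π` is a (stochastic) policy: `π s` is a distribution over actions. -/
def IsPolicy {S A : Type*} [Fintype A] (π : S → A → ℝ) : Prop :=
  ∀ s, IsDist (π s)

/-- One-step evolution of a state distribution under policy `π` and dynamics `P`. -/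
def step {S A : Type*} [Fintype S] [Fintype A]
    (P : S → A → S → ℝ) (π : S → A → ℝ) (d : S → ℝ) : S → ℝ :=
  fun s' => ∑ s, ∑ a, d s * π s a * P s a s'

/-- The time-`t` state distribution `d_π^t` starting from `ρ₀`. -/
def stateDist {S A : Type*} [Fintype S] [Fintype A]
    (P : S → A → S → ℝ) (π : S → A → ℝ) (ρ₀ : S → ℝ) : ℕ → S → ℝ
  | 0 => ρ₀
  | t + 1 => step P π (stateDist P π ρ₀ t)

/-- Discounted state visitation distribution `d_π = (1-γ) Σ_t γ^t d_π^t`. -/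
def visit {S A : Type*} [Fintype S] [Fintype A]
    (γ : ℝ) (P : S → A → S → ℝ) (π : S → A → ℝ) (ρ₀ : S → ℝ) : S → ℝ :=
  fun s => (1 - γ) * ∑' t : ℕ, γ ^ t * stateDist P π ρ₀ t s

/-- Expected cost of one step when the state is distributed as `d` and actions follow `π`. -/
def expCost {S A : Type*} [Fintype S] [Fintype A]
    (c : S → A → ℝ) (π : S → A → ℝ) (d : S → ℝ) : ℝ :=
  ∑ s, ∑ a, d s * π s a * c s a

/-- Value function `V^π(s₀)`: expected total discounted cost starting at `s₀`. -/
def Vf {S A : Type*} [Fintype S] [Fintype A] [DecidableEq S]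
    (γ : ℝ) (P : S → A → S → ℝ) (c : S → A → ℝ) (π : S → A → ℝ) (s₀ : S) : ℝ :=
  ∑' t : ℕ, γ ^ t * expCost c π (stateDist P π (fun s => if s = s₀ then 1 else 0) t)

/-- Objective `J(π) = E_{s∼ρ₀}[V^π(s)]`. -/
def Jf {S A : Type*} [Fintype S] [Fintype A] [DecidableEq S]
    (γ : ℝ) (P : S → A → S → ℝ) (c : S → A → ℝ) (ρ₀ : S → ℝ) (π : S → A → ℝ) : ℝ :=
  ∑ s, ρ₀ s * Vf γ P c π s

/-- State-action value `Q^π(s,a) = c(s,a) + γ E_{s'∼P_{s,a}}[V^π(s')]`. -/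
def Qf {S A : Type*} [Fintype S] [Fintype A] [DecidableEq S]
    (γ : ℝ) (P : S → A → S → ℝ) (c : S → A → ℝ) (π : S → A → ℝ) (s : S) (a : A) : ℝ :=
  c s a + γ * ∑ s', P s a s' * Vf γ P c π s'

/-- Disadvantage function `A^π(s,a) = Q^π(s,a) - V^π(s)`. -/
def Adv {S A : Type*} [Fintype S] [Fintype A] [DecidableEq S]
    (γ : ℝ) (P : S → A → S → ℝ) (c : S → A → ℝ) (π : S → A → ℝ) (s : S) (a : A) : ℝ :=
  Qf γ P c π s a - Vf γ P c π s

section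

variable {S A : Type*} [Fintype S] [Fintype A]

lemma IsDist.le_one {X : Type*} [Fintype X] {p : X → ℝ} (hp : IsDist p) (x : X) : p x ≤ 1 :=
  hp.2 ▸ Finset.single_le_sum (fun y _ => hp.1 y) (Finset.mem_univ x)

lemma IsDist.iInf_le_sum_mul {X : Type*} [Fintype X] {p : X → ℝ} (hp : IsDist p) (f : X → ℝ) :
    ⨅ x, f x ≤ ∑ x, p x * f x := by
  calc ⨅ x, f x = ∑ x, p x * ⨅ x, f x := by rw [← Finset.sum_mul, hp.2, one_mul]
    _ ≤ _ := Finset.sum_le_sum fun x _ => mul_le_mul_of_nonneg_left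
      (ciInf_le (Set.finite_range f).bddBelow x) (hp.1 x)

lemma isDist_pointMass [DecidableEq S] (s₀ : S) :
    IsDist (fun s => if s = s₀ then (1 : ℝ) else 0) :=
  ⟨fun s => by dsimp only; split_ifs <;> norm_num, by simp⟩

lemma IsDist.step {P : S → A → S → ℝ} {π : S → A → ℝ} {d : S → ℝ}
    (hP : IsDynamics P) (hπ : IsPolicy π) (hd : IsDist d) : IsDist (step P π d) := by
  refine ⟨fun s' => Finset.sum_nonneg fun s _ => Finset.sum_nonneg fun a _ =>
    mul_nonneg (mul_nonneg (hd.1 s) ((hπ s).1 a)) ((hP s a).1 s'), ?_⟩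
  unfold _root_.step
  rw [Finset.sum_comm]
  simp_rw [Finset.sum_comm (s := (Finset.univ : Finset S)) (t := (Finset.univ : Finset A)),
    ← Finset.mul_sum, (hP _ _).2, mul_one]
  rw [Finset.sum_comm]
  simp_rw [← Finset.mul_sum, (hπ _).2, mul_one]
  exact hd.2

lemma IsDist.stateDist {P : S → A → S → ℝ} {π : S → A → ℝ} {ρ : S → ℝ}
    (hP : IsDynamics P) (hπ : IsPolicy π) (hρ : IsDist ρ) (t : ℕ) :
    IsDist (stateDist P π ρ t) := by
  induction t with
  | zero => exact hρ
  | succ t ih => exact ih.step hP hπ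

lemma stateDist_succ' (P : S → A → S → ℝ) (π : S → A → ℝ) (ρ : S → ℝ) (t : ℕ) :
    stateDist P π ρ (t + 1) = stateDist P π (step P π ρ) t := by
  induction t with
  | zero => rfl
  | succ t ih => rw [stateDist, ih, stateDist]

lemma step_sum (P : S → A → S → ℝ) (π : S → A → ℝ) (w : S → ℝ) (d : S → S → ℝ) (s' : S) :
    step P π (fun s => ∑ x, w x * d x s) s' = ∑ x, w x * step P π (d x) s' := by
  simp only [step, Finset.sum_mul, Finset.mul_sum]
  conv_rhs => rw [Finset.sum_comm]
  refine Finset.sum_congr rfl fun s _ => ?_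
  conv_rhs => rw [Finset.sum_comm]
  exact Finset.sum_congr rfl fun a _ => Finset.sum_congr rfl fun x _ => by ring

lemma stateDist_eq_sum_pointMass [DecidableEq S] (P : S → A → S → ℝ) (π : S → A → ℝ)
    (ρ : S → ℝ) (t : ℕ) :
    stateDist P π ρ t =
      fun s' => ∑ x, ρ x * stateDist P π (fun s => if s = x then 1 else 0) t s' := by
  induction t with
  | zero => ext s'; simp [stateDist]
  | succ t ih =>
    ext s'
    rw [stateDist, ih, step_sum]
    rfl

lemma expCost_sum (c : S → A → ℝ) (π : S → A → ℝ) (w : S → ℝ) (d : S → S → ℝ) :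
    expCost c π (fun s => ∑ x, w x * d x s) = ∑ x, w x * expCost c π (d x) := by
  simp only [expCost, Finset.sum_mul, Finset.mul_sum]
  conv_rhs => rw [Finset.sum_comm]
  refine Finset.sum_congr rfl fun s _ => ?_
  conv_rhs => rw [Finset.sum_comm]
  exact Finset.sum_congr rfl fun a _ => Finset.sum_congr rfl fun x _ => by ring

lemma summable_discounted_stateDist {γ : ℝ} {P : S → A → S → ℝ} {π : S → A → ℝ} {ρ : S → ℝ}
    (hγ : 0 ≤ γ) (hγ' : γ < 1) (hP : IsDynamics P) (hπ : IsPolicy π) (hρ : IsDist ρ) (s : S) :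
    Summable fun t : ℕ => γ ^ t * stateDist P π ρ t s :=
  (summable_geometric_of_lt_one hγ hγ').of_nonneg_of_le
    (fun t => mul_nonneg (pow_nonneg hγ t) ((hρ.stateDist hP hπ t).1 s))
    (fun t => mul_le_of_le_one_right (pow_nonneg hγ t) ((hρ.stateDist hP hπ t).le_one s))

lemma summable_discounted_expCost {γ : ℝ} {P : S → A → S → ℝ} {π : S → A → ℝ} {ρ : S → ℝ}
    (c : S → A → ℝ) (hγ : 0 ≤ γ) (hγ' : γ < 1) (hP : IsDynamics P) (hπ : IsPolicy π)
    (hρ : IsDist ρ) :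
    Summable fun t : ℕ => γ ^ t * expCost c π (stateDist P π ρ t) := by
  simp only [expCost, Finset.mul_sum]
  refine summable_sum fun s _ => summable_sum fun a _ => ?_
  refine ((summable_discounted_stateDist hγ hγ' hP hπ hρ s).mul_right (π s a * c s a)).congr
    fun t => by ring

lemma visit_eq_add_step {γ : ℝ} {P : S → A → S → ℝ} {π : S → A → ℝ} {ρ : S → ℝ}
    (hγ : 0 ≤ γ) (hγ' : γ < 1) (hP : IsDynamics P) (hπ : IsPolicy π) (hρ : IsDist ρ) (s' : S) :
    visit γ P π ρ s' = (1 - γ) * ρ s' + γ * step P π (visit γ P π ρ) s' := by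
  have hstep : ∑' t : ℕ, γ ^ (t + 1) * stateDist P π ρ (t + 1) s' =
      γ * ∑ s, ∑ a, (∑' t : ℕ, γ ^ t * stateDist P π ρ t s) * (π s a * P s a s') := by
    have h : HasSum (fun t : ℕ => γ * ∑ s, ∑ a,
        (γ ^ t * stateDist P π ρ t s) * (π s a * P s a s')) _ :=
      (hasSum_sum fun s _ => hasSum_sum fun a _ =>
        (summable_discounted_stateDist hγ hγ' hP hπ hρ s).hasSum.mul_right
          (π s a * P s a s')).mul_left γ
    rw [← h.tsum_eq]
    refine tsum_congr fun t => ?_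
    simp only [stateDist, step, Finset.mul_sum]
    exact Finset.sum_congr rfl fun s _ => Finset.sum_congr rfl fun a _ => by ring
  rw [visit, (summable_discounted_stateDist hγ hγ' hP hπ hρ s').tsum_eq_zero_add, hstep]
  simp only [visit, step, stateDist, pow_zero, one_mul, mul_add, Finset.mul_sum]
  exact congrArg _ (Finset.sum_congr rfl fun s _ => Finset.sum_congr rfl fun a _ => by ring)

lemma visit_nonneg {γ : ℝ} {P : S → A → S → ℝ} {π : S → A → ℝ} {ρ : S → ℝ}
    (hγ : 0 ≤ γ) (hγ' : γ < 1) (hP : IsDynamics P) (hπ : IsPolicy π) (hρ : IsDist ρ) (s : S) :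
    0 ≤ visit γ P π ρ s :=
  mul_nonneg (sub_nonneg.2 hγ'.le) (tsum_nonneg fun t =>
    mul_nonneg (pow_nonneg hγ t) ((hρ.stateDist hP hπ t).1 s))

lemma one_sub_mul_le_visit {γ : ℝ} {P : S → A → S → ℝ} {π : S → A → ℝ} {ρ : S → ℝ}
    (hγ : 0 ≤ γ) (hγ' : γ < 1) (hP : IsDynamics P) (hπ : IsPolicy π) (hρ : IsDist ρ) (s : S) :
    (1 - γ) * ρ s ≤ visit γ P π ρ s := by
  rw [visit_eq_add_step hγ hγ' hP hπ hρ]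
  refine le_add_of_nonneg_right (mul_nonneg hγ ?_)
  exact Finset.sum_nonneg fun x _ => Finset.sum_nonneg fun a _ =>
    mul_nonneg (mul_nonneg (visit_nonneg hγ hγ' hP hπ hρ x) ((hπ x).1 a)) ((hP x a).1 s)

variable [DecidableEq S]

/-- The Bellman equation. -/
lemma Vf_eq_sum_Qf {γ : ℝ} {P : S → A → S → ℝ} {π : S → A → ℝ} (c : S → A → ℝ)
    (hγ : 0 ≤ γ) (hγ' : γ < 1) (hP : IsDynamics P) (hπ : IsPolicy π) (s : S) :
    Vf γ P c π s = ∑ a, π s a * Qf γ P c π s a := by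
  have hsum := fun x : S =>
    summable_discounted_expCost c hγ hγ' hP hπ (isDist_pointMass x)
  have htail : ∑' t : ℕ, γ ^ (t + 1) *
      expCost c π (stateDist P π (fun x => if x = s then 1 else 0) (t + 1)) =
      γ * ∑ x, step P π (fun x => if x = s then 1 else 0) x * Vf γ P c π x := by
    have h := (hasSum_sum (s := Finset.univ) fun x _ => (hsum x).hasSum.mul_left
      (step P π (fun x => if x = s then 1 else 0) x)).mul_left γ
    refine Eq.trans (tsum_congr fun t => ?_) h.tsum_eq
    rw [stateDist_succ', stateDist_eq_sum_pointMass, expCost_sum]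
    simp only [Finset.mul_sum]
    exact Finset.sum_congr rfl fun x _ => by ring
  rw [Vf, (hsum s).tsum_eq_zero_add, htail]
  simp only [stateDist, expCost, step, Qf, ite_mul, one_mul, zero_mul, pow_zero]
  simp only [Finset.sum_ite_irrel, Finset.sum_const_zero, Finset.sum_ite_eq', Finset.mem_univ,
    if_true, mul_add, Finset.sum_add_distrib, Finset.mul_sum, Finset.sum_mul]
  rw [Finset.sum_comm]
  exact congrArg _ (Finset.sum_congr rfl fun a _ => Finset.sum_congr rfl fun x _ => by ring)

lemma sum_policy_mul_Adv_self {γ : ℝ} {P : S → A → S → ℝ} {π : S → A → ℝ} (c : S → A → ℝ)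
    (hγ : 0 ≤ γ) (hγ' : γ < 1) (hP : IsDynamics P) (hπ : IsPolicy π) (s : S) :
    ∑ a, π s a * Adv γ P c π s a = 0 := by
  simp only [Adv, mul_sub, Finset.sum_sub_distrib, ← Finset.sum_mul, (hπ s).2, one_mul]
  rw [← Vf_eq_sum_Qf c hγ hγ' hP hπ, sub_self]

lemma sum_visit_mul_Adv {γ : ℝ} {P : S → A → S → ℝ} {π : S → A → ℝ} {ρ : S → ℝ}
    (c : S → A → ℝ) (η : S → A → ℝ)
    (hγ : 0 ≤ γ) (hγ' : γ < 1) (hP : IsDynamics P) (hπ : IsPolicy π) (hρ : IsDist ρ) :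
    ∑ s, visit γ P π ρ s * ∑ a, π s a * Adv γ P c η s a =
      expCost c π (visit γ P π ρ) - (1 - γ) * Jf γ P c ρ η := by
  have hflow : ∑ s, visit γ P π ρ s * Vf γ P c η s = (1 - γ) * Jf γ P c ρ η +
      γ * ∑ s, step P π (visit γ P π ρ) s * Vf γ P c η s := by
    simp only [Jf, Finset.mul_sum, ← Finset.sum_add_distrib]
    refine Finset.sum_congr rfl fun s _ => ?_
    conv_lhs => rw [visit_eq_add_step hγ hγ' hP hπ hρ]
    ring
  have hnext : ∑ s, step P π (visit γ P π ρ) s * Vf γ P c η s =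
      ∑ s, ∑ a, visit γ P π ρ s * π s a * ∑ s', P s a s' * Vf γ P c η s' := by
    simp only [step, Finset.sum_mul, Finset.mul_sum]
    rw [Finset.sum_comm]
    refine Finset.sum_congr rfl fun s _ => ?_
    rw [Finset.sum_comm]
    exact Finset.sum_congr rfl fun a _ => Finset.sum_congr rfl fun x _ => by ring
  have hinner : ∀ s, visit γ P π ρ s * ∑ a, π s a * Adv γ P c η s a =
      ∑ a, visit γ P π ρ s * π s a * c s a +
      γ * ∑ a, visit γ P π ρ s * π s a * ∑ s', P s a s' * Vf γ P c η s' -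
      visit γ P π ρ s * Vf γ P c η s := by
    intro s
    simp only [Adv, Qf, mul_sub, mul_add, Finset.sum_sub_distrib, Finset.sum_add_distrib,
      ← Finset.sum_mul, (hπ s).2, one_mul]
    simp only [Finset.mul_sum]
    congr 2
    · exact Finset.sum_congr rfl fun a _ => by ring
    · exact Finset.sum_congr rfl fun a _ => Finset.sum_congr rfl fun x _ => by ring
  simp only [hinner, Finset.sum_sub_distrib, Finset.sum_add_distrib, ← Finset.mul_sum]
  rw [hflow, hnext, expCost]
  ring

/-- The performance difference lemma. -/
lemma performance_difference {γ : ℝ} {P : S → A → S → ℝ} {π η : S → A → ℝ} {ρ : S → ℝ}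
    (c : S → A → ℝ) (hγ : 0 ≤ γ) (hγ' : γ < 1) (hP : IsDynamics P)
    (hπ : IsPolicy π) (hρ : IsDist ρ) :
    ∑ s, visit γ P π ρ s * ∑ a, π s a * Adv γ P c η s a =
      (1 - γ) * (Jf γ P c ρ π - Jf γ P c ρ η) := by
  have h := sum_visit_mul_Adv c π hγ hγ' hP hπ hρ
  simp only [sum_policy_mul_Adv_self c hγ hγ' hP hπ, mul_zero, Finset.sum_const_zero] at h
  rw [sum_visit_mul_Adv c η hγ hγ' hP hπ hρ]
  linarith

end

/-- **Theorem 3.** Under realizability and positivity of `ρ₀` and `d_{π_n}`, if the mixture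
policy `(1-β)π_n + βπ*_n` has average disadvantage at least `-ξ` and
`0 ≤ Δ = J(π_n) - J(η_n) ≤ ξ`, then
`J(η_n) - J(π*) ≤ (max_s d_{π*}(s)/ρ₀(s)) * (ξ/(β(1-γ)²) + ξ/(β(1-γ)))`. -/
theorem dpi_theorem_three
    {S A : Type*} [Fintype S] [Fintype A] [Nonempty S] [Nonempty A] [DecidableEq S]
    (γ : ℝ) (P : S → A → S → ℝ) (c : S → A → ℝ) (ρ₀ : S → ℝ)
    (hγ : 0 < γ) (hγ' : γ < 1) (hP : IsDynamics P) (hρ : IsDist ρ₀)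
    (hc : ∀ s a, 0 ≤ c s a ∧ c s a ≤ 1)
    (πn ηn πstarn πopt : S → A → ℝ)
    (hπn : IsPolicy πn) (hηn : IsPolicy ηn) (hπstarn : IsPolicy πstarn)
    (hπopt : IsPolicy πopt)
    (hopt : ∀ π : S → A → ℝ, IsPolicy π → Jf γ P c ρ₀ πopt ≤ Jf γ P c ρ₀ π)
    (β ξ : ℝ) (hβ : 0 < β) (hβ1 : β ≤ 1) (hξ : 0 ≤ ξ)
    (hρpos : ∀ s, 0 < ρ₀ s) (hdpos : ∀ s, 0 < visit γ P πn ρ₀ s)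
    (hrealizable : ∑ s, visit γ P πn ρ₀ s * ∑ a, πstarn s a * Adv γ P c ηn s a =
      ∑ s, visit γ P πn ρ₀ s * ⨅ a : A, Adv γ P c ηn s a)
    (hmix : -ξ ≤ ∑ s, visit γ P πn ρ₀ s *
      ∑ a, ((1 - β) * πn s a + β * πstarn s a) * Adv γ P c ηn s a)
    (hΔ0 : 0 ≤ Jf γ P c ρ₀ πn - Jf γ P c ρ₀ ηn)
    (hΔξ : Jf γ P c ρ₀ πn - Jf γ P c ρ₀ ηn ≤ ξ) :
    Jf γ P c ρ₀ ηn - Jf γ P c ρ₀ πopt ≤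
      (⨆ s : S, visit γ P πopt ρ₀ s / ρ₀ s) *
        (ξ / (β * (1 - γ) ^ 2) + ξ / (β * (1 - γ))) := by
  have hγ0 := hγ.le
  have h1γ : 0 < 1 - γ := sub_pos.2 hγ'
  set m : S → ℝ := fun s => ⨅ a, Adv γ P c ηn s a
  set C : ℝ := ⨆ s, visit γ P πopt ρ₀ s / ρ₀ s
  have hm0 : ∀ s, m s ≤ 0 := fun s =>
    ((hηn s).iInf_le_sum_mul _).trans_eq (sum_policy_mul_Adv_self c hγ0 hγ' hP hηn s)
  have hCle : ∀ s, visit γ P πopt ρ₀ s ≤ C * ρ₀ s := fun s =>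
    (div_le_iff₀ (hρpos s)).1
      (le_ciSup (f := fun s => visit γ P πopt ρ₀ s / ρ₀ s) (Set.finite_range _).bddAbove s)
  have hC0 : 0 ≤ C := Real.iSup_nonneg fun s =>
    div_nonneg (visit_nonneg hγ0 hγ' hP hπopt hρ s) (hρpos s).le
  have hM : -(∑ s, visit γ P πn ρ₀ s * m s) * β ≤ ξ + (1 - γ) * ξ := by
    have hsplit : ∑ s, visit γ P πn ρ₀ s *
        ∑ a, ((1 - β) * πn s a + β * πstarn s a) * Adv γ P c ηn s a =
        (1 - β) * ∑ s, visit γ P πn ρ₀ s * ∑ a, πn s a * Adv γ P c ηn s a +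
        β * ∑ s, visit γ P πn ρ₀ s * ∑ a, πstarn s a * Adv γ P c ηn s a := by
      simp only [Finset.mul_sum, ← Finset.sum_add_distrib]
      exact Finset.sum_congr rfl fun s _ => Finset.sum_congr rfl fun a _ => by ring
    rw [hsplit, hrealizable, performance_difference c hγ0 hγ' hP hπn hρ] at hmix
    have h1 : (1 - β) * ((1 - γ) * (Jf γ P c ρ₀ πn - Jf γ P c ρ₀ ηn)) ≤ (1 - γ) * ξ :=
      (mul_le_of_le_one_left (mul_nonneg h1γ.le hΔ0) (by linarith)).trans
        (mul_le_mul_of_nonneg_left hΔξ h1γ.le)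
    linarith
  have hopt_lower : ∑ s, visit γ P πopt ρ₀ s * m s ≤
      (1 - γ) * (Jf γ P c ρ₀ πopt - Jf γ P c ρ₀ ηn) := by
    rw [← performance_difference c hγ0 hγ' hP hπopt hρ]
    exact Finset.sum_le_sum fun s _ => mul_le_mul_of_nonneg_left
      ((hπopt s).iInf_le_sum_mul _) (visit_nonneg hγ0 hγ' hP hπopt hρ s)
  have hchange : C * ∑ s, visit γ P πn ρ₀ s * m s ≤
      (1 - γ) * ∑ s, visit γ P πopt ρ₀ s * m s := by
    rw [Finset.mul_sum, Finset.mul_sum]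
    refine Finset.sum_le_sum fun s _ => ?_
    have h : (1 - γ) * visit γ P πopt ρ₀ s ≤ C * visit γ P πn ρ₀ s :=
      calc (1 - γ) * visit γ P πopt ρ₀ s ≤ (1 - γ) * (C * ρ₀ s) :=
            mul_le_mul_of_nonneg_left (hCle s) h1γ.le
        _ = C * ((1 - γ) * ρ₀ s) := by ring
        _ ≤ _ := mul_le_mul_of_nonneg_left (one_sub_mul_le_visit hγ0 hγ' hP hπn hρ s) hC0
    simpa only [mul_assoc] using mul_le_mul_of_nonpos_right h (hm0 s)
  have hrhs : C * (ξ / (β * (1 - γ) ^ 2) + ξ / (β * (1 - γ))) =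
      C * (ξ + (1 - γ) * ξ) / (β * (1 - γ) ^ 2) := by
    field_simp
  rw [hrhs, le_div_iff₀ (by positivity)]
  have h1 := mul_le_mul_of_nonneg_left hM hC0
  have h2 := mul_le_mul_of_nonneg_left hopt_lower (mul_nonneg hβ.le h1γ.le)
  have h3 := mul_le_mul_of_nonneg_left hchange hβ.le
  nlinarith
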